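/- arXiv:1605.07076 — 3 statements merged into one kernel-verified Lean document; each statement's English description precedes it below -/
import Mathlib

section
/- Let E = F[γ] be a separable extension of the local field F of degree n, residue degree f, and discriminant exponent δ, with γ ∈ E^×. Let D_F(γ) = det_F(1 − Ad_γ ; A(E)/E), where A(E) = End_F(E) and Ad_γ(u) = γuγ^{−1}. Then c̃_F(γ) = (ν_F(D_F(γ)) − δ)/f. -/
/-- The conjugation operator `Ad_γ : u ↦ (lmul γ) ∘ u ∘ (lmul γ⁻¹)` on `A(E) = End_F(E)`. -/
noncomputable def adConj (F E : Type*) [Field F] [Field E] [Algebra F E] (γ : E) :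
    Module.End F E →ₗ[F] Module.End F E :=
  (LinearMap.mulLeft F (Algebra.lmul F E γ)).comp
    (LinearMap.mulRight F (Algebra.lmul F E γ⁻¹))

/-- The subspace `E ⊆ A(E) = End_F(E)` of multiplication operators. -/
noncomputable def lmulRange (F E : Type*) [Field F] [Field E] [Algebra F E] :
    Submodule F (Module.End F E) :=
  LinearMap.range (Algebra.lmul F E).toLinearMap

open Polynomial

section Line

variable {K V : Type*} [Field K] [AddCommGroup V] [Module K V] [FiniteDimensional K V]
  {W : Submodule K V}

/-- If `T` acts by the scalar `c` on a line `W`, then `det T = c * det (T ; V/W)`. -/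
lemma LinearMap.det_eq_mul_det_mapQ (hW : Module.finrank K W = 1)
    {T : V →ₗ[K] V} {c : K} (hT : ∀ u ∈ W, T u = c • u) (hle : W ≤ W.comap T) :
    LinearMap.det T = c * LinearMap.det (W.mapQ W T hle) := by
  have hres : T.restrict (p := W) (q := W) hle = c • LinearMap.id := by
    ext1 u
    exact Subtype.ext (hT u u.2)
  rw [LinearMap.det_eq_det_mul_det W T hle, hres, LinearMap.det_smul, hW]
  simp

lemma LinearMap.charpoly_eq_mul_charpoly_mapQ [Infinite K] (hW : Module.finrank K W = 1)
    {R : V →ₗ[K] V} {c : K} (hR : ∀ u ∈ W, R u = c • u) (hle : W ≤ W.comap R) :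
    R.charpoly = (X - C c) * (W.mapQ W R hle).charpoly := by
  refine Polynomial.funext fun a => ?_
  have hle' : W ≤ W.comap (algebraMap K (Module.End K V) a - R) := fun u hu =>
    W.sub_mem (W.smul_mem a hu) (hle hu)
  have hQ : W.mapQ W (algebraMap K (Module.End K V) a - R) hle' =
      algebraMap K (Module.End K (V ⧸ W)) a - W.mapQ W R hle := by
    apply Submodule.linearMap_qext
    rfl
  have hT : ∀ u ∈ W, (algebraMap K (Module.End K V) a - R) u = (a - c) • u := fun u hu => by
    simp [hR u hu, sub_smul]
  rw [eval_mul, LinearMap.eval_charpoly, LinearMap.eval_charpoly,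
    LinearMap.det_eq_mul_det_mapQ hW hT hle', hQ]
  simp

lemma LinearMap.det_mul_det_mapQ_id_sub_smul [Infinite K] (hW : Module.finrank K W = 1)
    {R S : V →ₗ[K] V} {c : K} (hR : ∀ u ∈ W, R u = c • u) (hSR : S ∘ₗ R = LinearMap.id)
    (hleR : W ≤ W.comap R) (hle : W ≤ W.comap (LinearMap.id - c • S)) :
    ∃ k : ℕ, LinearMap.det R * LinearMap.det (W.mapQ W (LinearMap.id - c • S) hle) =
      (-1) ^ k * (c * (derivative R.charpoly).eval c) := by
  refine ⟨Module.finrank K (V ⧸ W), ?_⟩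
  have hder : (derivative R.charpoly).eval c = (W.mapQ W R hleR).charpoly.eval c := by
    rw [LinearMap.charpoly_eq_mul_charpoly_mapQ hW hR hleR]
    simp
  have hcomp : W.mapQ W (LinearMap.id - c • S) hle ∘ₗ W.mapQ W R hleR =
      (-1 : K) • (algebraMap K (Module.End K (V ⧸ W)) c - W.mapQ W R hleR) := by
    apply Submodule.linearMap_qext
    ext1 u
    have hu : S (R u) = u := LinearMap.congr_fun hSR u
    simp [hu]
  rw [hder, LinearMap.eval_charpoly, LinearMap.det_eq_mul_det_mapQ hW hR hleR, mul_assoc,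
    mul_comm (LinearMap.det (W.mapQ W R hleR)), ← LinearMap.det_comp, hcomp, LinearMap.det_smul]
  ring

lemma LinearMap.det_mapQ_eq_norm {F : Type*} [Field F] [Algebra F K] [FiniteDimensional F K]
    [Module F V] [IsScalarTower F K V] {W' : Submodule F V} (hW' : W.restrictScalars F = W')
    {T : V →ₗ[K] V} {T' : V →ₗ[F] V} (hT : ∀ u, T u = T' u)
    (hle : W ≤ W.comap T) (hle' : W' ≤ W'.comap T') :
    LinearMap.det (W'.mapQ W' T' hle') = Algebra.norm F (LinearMap.det (W.mapQ W T hle)) := by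
  subst hW'
  rw [← LinearMap.det_restrictScalars,
    ← LinearMap.det_conj _ (Submodule.Quotient.restrictScalarsEquiv F W)]
  congr 1
  ext1 x
  obtain ⟨u, rfl⟩ := Submodule.Quotient.mk_surjective _ x
  exact congr_arg (Submodule.Quotient.mk (p := W)) (hT u).symm

end Line

section Determinant

variable {F E : Type*} [Field F] [Field E] [Algebra F E]

/-- Precomposition with multiplication by `γ` on `End_F(E)`, linear over `E` acting on the
target. -/
noncomputable def precompMul (F : Type*) {E : Type*} [Field F] [Field E] [Algebra F E] (γ : E) :
    (E →ₗ[F] E) →ₗ[E] (E →ₗ[F] E) :=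
  LinearMap.lcomp E E (Algebra.lmul F E γ)

/-- The line of multiplication operators, as an `E`-subspace of `End_F(E)`. -/
noncomputable def mulLine (F E : Type*) [Field F] [Field E] [Algebra F E] :
    Submodule E (E →ₗ[F] E) :=
  Submodule.span E {LinearMap.id}

lemma precompMul_id (γ : E) : precompMul F γ LinearMap.id = γ • LinearMap.id := by
  ext x
  simp [precompMul]

lemma precompMul_of_mem (γ : E) (u : E →ₗ[F] E) (hu : u ∈ mulLine F E) :
    precompMul F γ u = γ • u := by
  obtain ⟨a, rfl⟩ := Submodule.mem_span_singleton.1 hu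
  rw [map_smul, precompMul_id, smul_comm]

lemma mulLine_le_comap (γ : E) : mulLine F E ≤ (mulLine F E).comap (precompMul F γ) := by
  intro u hu
  rw [Submodule.mem_comap, precompMul_of_mem γ u hu]
  exact Submodule.smul_mem _ _ hu

lemma restrictScalars_mulLine : (mulLine F E).restrictScalars F = lmulRange F E := by
  ext u
  simp only [Submodule.restrictScalars_mem, mulLine, lmulRange, Submodule.mem_span_singleton,
    LinearMap.mem_range]
  refine exists_congr fun a => ?_
  have : a • LinearMap.id = (Algebra.lmul F E).toLinearMap a := by
    ext x
    simp
  rw [this]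

lemma finrank_mulLine : Module.finrank E (mulLine F E) = 1 :=
  finrank_span_singleton fun h => one_ne_zero (α := E) (by simpa using LinearMap.congr_fun h 1)

/-- Conjugation by `γ` is unchanged when `γ` is multiplied by a nonzero scalar. -/
lemma adConj_algebraMap_mul {z : F} (hz : z ≠ 0) (γ : E) :
    adConj F E (algebraMap F E z * γ) = adConj F E γ := by
  have hz' : algebraMap F E z ≠ 0 := by simpa using hz
  ext u y
  have h : (algebraMap F E z * γ)⁻¹ * y = z⁻¹ • (γ⁻¹ * y) := by
    rw [Algebra.smul_def, map_inv₀, mul_inv, mul_assoc]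
  simp only [adConj, LinearMap.comp_apply, LinearMap.mulLeft_apply, LinearMap.mulRight_apply,
    Module.End.mul_apply, Algebra.coe_lmul_eq_mul, LinearMap.mul_apply', h, map_smul]
  rw [Algebra.smul_def, map_inv₀]
  field_simp

variable [FiniteDimensional F E]

omit [FiniteDimensional F E] in
lemma toMatrix_precompMul {ι : Type*} [Fintype ι] [DecidableEq ι] (b : Module.Basis ι F E)
    (γ : E) :
    LinearMap.toMatrix ((Pi.basisFun E ι).map (b.constr E)) ((Pi.basisFun E ι).map (b.constr E))
      (precompMul F γ) = (Algebra.leftMulMatrix b γ).transpose.map (algebraMap F E) := by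
  ext i j
  rw [LinearMap.toMatrix_apply]
  simp only [Module.Basis.map_repr, LinearEquiv.trans_apply, Pi.basisFun_repr,
    Module.Basis.map_apply, Pi.basisFun_apply, Matrix.map_apply, Matrix.transpose_apply,
    Algebra.leftMulMatrix_eq_repr_mul]
  rw [Module.Basis.constr_symm_apply, precompMul, LinearMap.lcomp_apply,
    Module.Basis.constr_apply_fintype]
  simp [Pi.single_apply, Algebra.smul_def]

lemma det_precompMul (γ : E) :
    LinearMap.det (precompMul F γ) = algebraMap F E (Algebra.norm F γ) := by
  let b := Module.finBasis F E
  rw [← LinearMap.det_toMatrix ((Pi.basisFun E _).map (b.constr E)), toMatrix_precompMul,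
    Algebra.norm_eq_matrix_det b, RingHom.map_det, RingHom.mapMatrix_apply, Matrix.transpose_map,
    Matrix.det_transpose]

lemma charpoly_precompMul {γ : E} (hγ : Algebra.adjoin F {γ} = ⊤) :
    (precompMul F γ).charpoly = (minpoly F γ).map (algebraMap F E) := by
  let b := PowerBasis.ofAdjoinEqTop (Algebra.IsIntegral.isIntegral (R := F) γ) hγ
  rw [← LinearMap.charpoly_toMatrix _ ((Pi.basisFun E _).map (b.basis.constr E)),
    toMatrix_precompMul, Matrix.charpoly_map, Matrix.charpoly_transpose]
  congr 1
  exact charpoly_leftMulMatrix b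

/-- Up to sign, `D_F(γ) = N_{E/F}(D)` with `N_{E/F}(γ) * D = γ * φ'(γ)`, where `φ` is the minimal
polynomial of `γ`. -/
lemma exists_det_mapQ_id_sub_adConj_eq_norm [Infinite E] {γ : E} (hγ0 : γ ≠ 0)
    (hγ : Algebra.adjoin F {γ} = ⊤)
    (hstab : lmulRange F E ≤ (lmulRange F E).comap
      ((LinearMap.id : Module.End F E →ₗ[F] Module.End F E) - adConj F E γ)) :
    ∃ (D : E) (k : ℕ), LinearMap.det (Submodule.mapQ (lmulRange F E) (lmulRange F E)
        ((LinearMap.id : Module.End F E →ₗ[F] Module.End F E) - adConj F E γ) hstab) =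
          Algebra.norm F D ∧
      algebraMap F E (Algebra.norm F γ) * D =
        (-1) ^ k * (γ * aeval γ (derivative (minpoly F γ))) := by
  have hle : mulLine F E ≤ (mulLine F E).comap
      ((LinearMap.id : (E →ₗ[F] E) →ₗ[E] (E →ₗ[F] E)) - γ • precompMul F γ⁻¹) := by
    intro u hu
    exact Submodule.sub_mem _ hu (Submodule.smul_mem _ _ (mulLine_le_comap γ⁻¹ hu))
  have hSR : precompMul F γ⁻¹ ∘ₗ precompMul F γ = LinearMap.id := by
    ext u y
    simp [precompMul, hγ0]
  obtain ⟨k, hk⟩ := LinearMap.det_mul_det_mapQ_id_sub_smul (K := E)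
    (V := E →ₗ[F] E) (W := mulLine F E) finrank_mulLine
    (precompMul_of_mem γ) hSR (mulLine_le_comap γ) hle
  rw [det_precompMul, charpoly_precompMul hγ, derivative_map, eval_map_algebraMap] at hk
  refine ⟨_, k, LinearMap.det_mapQ_eq_norm (K := E) (V := E →ₗ[F] E)
    (W := mulLine F E) restrictScalars_mulLine (fun u => ?_) hle hstab, hk⟩
  ext y
  simp [adConj, precompMul]

end Determinant

section Valuation

/-- `v` restricts to a surjective additive valuation on the nonzero elements of `K`; its value at
`0` is irrelevant. -/
structure IsNormalizedVal {K : Type*} [Field K] (v : K → ℤ) : Prop where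
  map_mul : ∀ x y : K, x ≠ 0 → y ≠ 0 → v (x * y) = v x + v y
  map_add : ∀ x y : K, x ≠ 0 → y ≠ 0 → x + y ≠ 0 → min (v x) (v y) ≤ v (x + y)
  surj : ∀ m : ℤ, ∃ x : K, x ≠ 0 ∧ v x = m

namespace IsNormalizedVal

variable {K : Type*} [Field K] {v : K → ℤ} (hv : IsNormalizedVal v)
include hv

lemma map_one : v 1 = 0 := by
  have := hv.map_mul 1 1 one_ne_zero one_ne_zero
  rw [mul_one] at this
  omega

lemma map_neg_one_pow_mul (k : ℕ) {x : K} (hx : x ≠ 0) : v ((-1) ^ k * x) = v x := by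
  have h1 : (-1 : K) ≠ 0 := neg_ne_zero.2 one_ne_zero
  have h := hv.map_mul (-1) (-1) h1 h1
  rw [neg_one_mul, neg_neg, hv.map_one] at h
  rcases neg_one_pow_eq_or K k with hk | hk
  · rw [hk, one_mul]
  · rw [hk, hv.map_mul _ _ h1 hx]
    omega

lemma map_inv {x : K} (hx : x ≠ 0) : v x⁻¹ = -v x := by
  have := hv.map_mul x x⁻¹ hx (inv_ne_zero hx)
  rw [mul_inv_cancel₀ hx, hv.map_one] at this
  omega

/-- The valuation ring of `v`. -/
def integer : ValuationSubring K where
  carrier := {x | x = 0 ∨ 0 ≤ v x}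
  zero_mem' := Or.inl rfl
  one_mem' := Or.inr hv.map_one.ge
  mul_mem' {x y} hx hy := by
    by_cases hx0 : x = 0
    · simp [hx0]
    by_cases hy0 : y = 0
    · simp [hy0]
    have := hx.resolve_left hx0
    have := hy.resolve_left hy0
    right
    rw [hv.map_mul x y hx0 hy0]
    omega
  add_mem' {x y} hx hy := by
    by_cases hx0 : x = 0
    · simpa [hx0] using hy
    by_cases hy0 : y = 0
    · simpa [hy0] using hx
    by_cases hxy : x + y = 0
    · exact Or.inl hxy
    have := hx.resolve_left hx0
    have := hy.resolve_left hy0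
    have := hv.map_add x y hx0 hy0 hxy
    right
    omega
  neg_mem' {x} hx := by
    by_cases hx0 : x = 0
    · simp [hx0]
    right
    have := hv.map_neg_one_pow_mul 1 hx0
    rw [pow_one, neg_one_mul] at this
    rw [this]
    exact hx.resolve_left hx0
  mem_or_inv_mem' x := by
    by_cases hx0 : x = 0
    · exact Or.inl (Or.inl hx0)
    rcases le_total 0 (v x) with h | h
    · exact Or.inl (Or.inr h)
    · refine Or.inr (Or.inr ?_)
      rw [hv.map_inv hx0]
      omega

lemma mem_integer {x : K} : x ∈ hv.integer ↔ x = 0 ∨ 0 ≤ v x := Iff.rfl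

lemma isPrincipalIdealRing_integer : IsPrincipalIdealRing hv.integer := by
  refine ⟨fun I => ?_⟩
  by_cases hI : I = ⊥
  · exact hI ▸ bot_isPrincipal
  obtain ⟨a₀, ha₀, ha₀0⟩ := Submodule.exists_mem_ne_zero_of_ne_bot hI
  obtain ⟨a, ⟨haI, ha0⟩, hmin⟩ := exists_minimalFor_of_wellFoundedLT
    (fun a : hv.integer => a ∈ I ∧ a ≠ 0) (fun a => (v a).toNat) ⟨a₀, ha₀, ha₀0⟩
  refine ⟨a, le_antisymm (fun b hb => ?_) ((Ideal.span_singleton_le_iff_mem I).2 haI)⟩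
  by_cases hb0 : b = 0
  · exact hb0 ▸ Submodule.zero_mem _
  have ha0' : (a : K) ≠ 0 := fun h => ha0 (Subtype.ext h)
  have hb0' : (b : K) ≠ 0 := fun h => hb0 (Subtype.ext h)
  have ha := (hv.mem_integer.1 a.2).resolve_left ha0'
  have hb' := (hv.mem_integer.1 b.2).resolve_left hb0'
  have hle : v a ≤ v b := by
    by_contra! h
    have := hmin (j := b) ⟨hb, hb0⟩ (by dsimp only; omega)
    dsimp only at this
    omega
  have hmem : (b : K) * (a : K)⁻¹ ∈ hv.integer := by
    refine hv.mem_integer.2 (Or.inr ?_)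
    rw [hv.map_mul _ _ hb0' (inv_ne_zero ha0'), hv.map_inv ha0']
    omega
  refine Ideal.mem_span_singleton'.2 ⟨⟨_, hmem⟩, Subtype.ext ?_⟩
  change (b : K) * (a : K)⁻¹ * a = b
  field_simp

end IsNormalizedVal

end Valuation

section Conductor

variable {F E : Type*} [Field F] [Field E] [Algebra F E] {vF : F → ℤ} {vE : E → ℤ}
  (hF : IsNormalizedVal vF) (hE : IsNormalizedVal vE) {e : ℤ} (he1 : 1 ≤ e)
  (hcompat : ∀ x : F, x ≠ 0 → vE (algebraMap F E x) = e * vF x)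

include hF hE he1 hcompat in
lemma exists_le_val_algebraMap_mul (m : ℤ) {x : E} (hx : x ≠ 0) :
    ∃ a : F, a ≠ 0 ∧ m ≤ vE (algebraMap F E a * x) := by
  obtain ⟨a, ha0, ha⟩ := hF.surj |m - vE x|
  refine ⟨a, ha0, ?_⟩
  rw [hE.map_mul _ _ (by simpa using ha0) hx, hcompat a ha0, ha]
  have h1 := le_abs_self (m - vE x)
  nlinarith [abs_nonneg (m - vE x)]

include he1 hcompat in
lemma algebraMap_mem_integer {a : F} (ha : a ∈ hF.integer) : algebraMap F E a ∈ hE.integer := by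
  by_cases ha0 : a = 0
  · simp [ha0]
  · refine hE.mem_integer.2 (Or.inr ?_)
    rw [hcompat a ha0]
    have := (hF.mem_integer.1 ha).resolve_left ha0
    positivity

/-- The valuation ring of `E` as an algebra over the valuation ring of `F`. -/
def integerSubalgebra : Subalgebra hF.integer E where
  __ := hE.integer.toSubring
  algebraMap_mem' a := algebraMap_mem_integer hF hE he1 hcompat a.2

lemma mem_integerSubalgebra {x : E} :
    x ∈ integerSubalgebra hF hE he1 hcompat ↔ x ∈ hE.integer := Iff.rfl

variable [FiniteDimensional F E] [Algebra.IsSeparable F E] {d : ℤ}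
  (hd : ∀ x : E, x ≠ 0 →
    ((∀ y ∈ hE.integer, Algebra.trace F E (x * y) ∈ hF.integer) ↔ -d ≤ vE x))

include hd in
lemma fg_integerSubalgebra : (integerSubalgebra hF hE he1 hcompat).toSubmodule.FG := by
  classical
  have := hF.isPrincipalIdealRing_integer
  let b := Module.finBasis F E
  choose a ha0 ha using fun i =>
    exists_le_val_algebraMap_mul hF hE he1 hcompat (-d) (b.ne_zero i)
  let b' := b.unitsSMul fun i => Units.mk0 (a i) (ha0 i)
  have hb' : ∀ i, b' i = algebraMap F E (a i) * b i := fun i => by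
    simp [b', Module.Basis.unitsSMul_apply, Units.smul_def, Algebra.smul_def]
  have hnd : (Algebra.traceForm F E).Nondegenerate := traceForm_nondegenerate F E
  refine Submodule.FG.of_le (T := Submodule.span hF.integer
    (Set.range ((Algebra.traceForm F E).dualBasis hnd b'))) ?_ ?_
  · exact Submodule.fg_span (Set.finite_range _)
  rw [← LinearMap.BilinForm.dualSubmodule_span_of_basis]
  intro x hx u hu
  induction hu using Submodule.span_induction with
  | mem u hu =>
    obtain ⟨i, rfl⟩ := hu
    have hne : algebraMap F E (a i) * b i ≠ 0 :=
      mul_ne_zero (by simpa using ha0 i) (b.ne_zero i)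
    have := (hd _ hne).2 (ha i) x hx
    rw [Algebra.traceForm_apply, hb', mul_comm]
    exact Submodule.mem_one.2 ⟨⟨_, this⟩, rfl⟩
  | zero => simp
  | add u w _ _ hu hw =>
    rw [map_add]
    exact Submodule.add_mem _ hu hw
  | smul r u _ hu =>
    rw [← algebraMap_smul F r u, map_smul, algebraMap_smul]
    exact Submodule.smul_mem _ _ hu

include hE he1 hcompat hd in
lemma isIntegral_of_mem_integer {x : E} (hx : x ∈ hE.integer) : IsIntegral hF.integer x :=
  .of_mem_of_fg _ (fg_integerSubalgebra hF hE he1 hcompat hd) x hx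

include he1 hcompat hd in
/-- The conductor-different formula: the elements multiplying `𝔬_E` into `𝔬_F[x]` form the ideal
`φ'(x) 𝔇⁻¹`, where `φ` is the minimal polynomial of `x`. -/
lemma forall_mul_mem_adjoin_iff {x : E} (hx : x ∈ hE.integer) (hgen : Algebra.adjoin F {x} = ⊤)
    {t : E} (ht : t ≠ 0) :
    (∀ y ∈ hE.integer, t * y ∈ Algebra.adjoin hF.integer {x}) ↔
      vE (aeval x (derivative (minpoly F x))) - d ≤ vE t := by
  set D := aeval x (derivative (minpoly F x)) with hD
  have hD0 : D ≠ 0 := (Algebra.IsSeparable.isSeparable F x).aeval_derivative_ne_zero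
    (minpoly.aeval F x)
  have hle : Algebra.adjoin hF.integer {x} ≤ integerSubalgebra hF hE he1 hcompat :=
    Algebra.adjoin_le (Set.singleton_subset_iff.2 hx)
  have hdual := traceForm_dualSubmodule_adjoin hF.integer F hgen
    (isIntegral_of_mem_integer hF hE he1 hcompat hd hx)
  have hmem : ∀ z : E, z ∈ Algebra.adjoin hF.integer {x} ↔
      ∀ w ∈ Algebra.adjoin hF.integer {x}, Algebra.trace F E (D⁻¹ * z * w) ∈ hF.integer := by
    intro z
    have h1 : D⁻¹ * z ∈ (Algebra.traceForm F E).dualSubmodule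
        (Subalgebra.toSubmodule (Algebra.adjoin hF.integer {x})) ↔
          z ∈ Algebra.adjoin hF.integer {x} := by
      rw [hdual, ← hD]
      exact Set.smul_mem_smul_set_iff₀ (inv_ne_zero hD0)
        (Algebra.adjoin hF.integer {x} : Set E) z
    rw [← h1, LinearMap.BilinForm.mem_dualSubmodule]
    refine forall₂_congr fun w _ => ?_
    rw [Algebra.traceForm_apply, Submodule.mem_one]
    exact ⟨fun ⟨r, hr⟩ => hr ▸ r.2, fun h => ⟨⟨_, h⟩, rfl⟩⟩
  have hval : vE (D⁻¹ * t) = vE t - vE D := by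
    rw [hE.map_mul _ _ (inv_ne_zero hD0) ht, hE.map_inv hD0]
    ring
  have key := hd (D⁻¹ * t) (mul_ne_zero (inv_ne_zero hD0) ht)
  rw [hval] at key
  rw [show vE D - d ≤ vE t ↔ -d ≤ vE t - vE D by constructor <;> intro <;> omega, ← key]
  refine ⟨fun h y hy => ?_, fun h y hy => (hmem _).2 fun w hw => ?_⟩
  · simpa [mul_assoc] using (hmem _).1 (h y hy) 1 (one_mem _)
  · simpa [mul_assoc] using h (y * w) (mul_mem hy (hle hw))

include hF hE he1 hcompat hd in
/-- The conductor exponent of `𝔬_F[x]` is the valuation of `φ'(x)` minus the exponent of the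
different. -/
lemma conductorExponent_eq {x : E} (hx : 0 ≤ vE x)
    (hgen : Algebra.adjoin F {x} = ⊤) {c : ℤ}
    (hc : ∀ t : E, t ≠ 0 →
        ((0 ≤ vE t ∧ ∀ y : E, (y = 0 ∨ 0 ≤ vE y) →
            t * y ∈ Subring.closure
              ({w : E | ∃ a : F, (a = 0 ∨ 0 ≤ vF a) ∧ algebraMap F E a = w} ∪ {x}))
          ↔ c ≤ vE t)) :
    c = vE (aeval x (derivative (minpoly F x))) - d := by
  have hclosure : ∀ z : E, z ∈ Subring.closure
      ({w : E | ∃ a : F, (a = 0 ∨ 0 ≤ vF a) ∧ algebraMap F E a = w} ∪ {x}) ↔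
        z ∈ Algebra.adjoin hF.integer {x} := by
    intro z
    rw [Algebra.mem_adjoin_iff]
    have : {w : E | ∃ a : F, (a = 0 ∨ 0 ≤ vF a) ∧ algebraMap F E a = w} =
        Set.range (algebraMap hF.integer E) := by
      ext w
      exact ⟨fun ⟨a, ha, h⟩ => ⟨⟨a, ha⟩, h⟩, fun ⟨a, h⟩ => ⟨a, a.2, h⟩⟩
    rw [this]
  have hxi : x ∈ hE.integer := Or.inr hx
  have hiff : ∀ t : E, t ≠ 0 →
      (c ≤ vE t ↔ vE (aeval x (derivative (minpoly F x))) - d ≤ vE t) := by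
    intro t ht
    rw [← hc t ht, ← forall_mul_mem_adjoin_iff hF hE he1 hcompat hd hxi hgen ht]
    simp only [hclosure]
    refine and_iff_right_of_imp fun h => ?_
    have h1 : t * 1 ∈ Algebra.adjoin hF.integer {x} := h 1 (one_mem hE.integer)
    rw [mul_one] at h1
    have hle : Algebra.adjoin hF.integer {x} ≤ integerSubalgebra hF hE he1 hcompat :=
      Algebra.adjoin_le (Set.singleton_subset_iff.2 hxi)
    exact (hE.mem_integer.1 (hle h1)).resolve_left ht
  obtain ⟨t, ht0, ht⟩ := hE.surj c
  obtain ⟨s, hs0, hs⟩ := hE.surj (vE (aeval x (derivative (minpoly F x))) - d)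
  have h1 := (hiff t ht0).1 ht.ge
  have h2 := (hiff s hs0).2 hs.ge
  omega

end Conductor

/-- Let `E = F[γ]` be a separable extension of the local field `F` of degree
`n`, residue degree `f`, and discriminant exponent `δ`, with `γ ∈ E^×`.  Let
`D_F(γ) = det_F(1 - Ad_γ ; A(E)/E)` with `A(E) = End_F(E)` and `Ad_γ(u) = γuγ⁻¹`.  Then
`c̃_F(γ) = (vF (D_F(γ)) - δ) / f`, i.e. `f · c̃_F(γ) = vF (D_F(γ)) - δ`, where
`c̃_F(γ) = c_F(γ) + (n-1)·n_F(γ)` with `c` the conductor-exponent invariant and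
`n_F(γ) = - vE γ`. -/
theorem statement4
    (F E : Type*) [Field F] [Field E] [Algebra F E] [FiniteDimensional F E]
    [Algebra.IsSeparable F E]
    (vF : F → ℤ) (vE : E → ℤ)
    (hvFmul : ∀ x y : F, x ≠ 0 → y ≠ 0 → vF (x * y) = vF x + vF y)
    (hvFadd : ∀ x y : F, x ≠ 0 → y ≠ 0 → x + y ≠ 0 → min (vF x) (vF y) ≤ vF (x + y))
    (hvFsurj : ∀ m : ℤ, ∃ x : F, x ≠ 0 ∧ vF x = m)
    (hvEmul : ∀ x y : E, x ≠ 0 → y ≠ 0 → vE (x * y) = vE x + vE y)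
    (hvEadd : ∀ x y : E, x ≠ 0 → y ≠ 0 → x + y ≠ 0 → min (vE x) (vE y) ≤ vE (x + y))
    (hvEsurj : ∀ m : ℤ, ∃ x : E, x ≠ 0 ∧ vE x = m)
    -- ramification index `e` and residue degree `f`:
    (e f : ℤ) (he1 : 1 ≤ e) (hf1 : 1 ≤ f)
    (hcompat : ∀ x : F, x ≠ 0 → vE (algebraMap F E x) = e * vF x)
    (hef : e * f = (Module.finrank F E : ℤ))
    (hnorm : ∀ x : E, x ≠ 0 → vF (Algebra.norm F x) = f * vE x)
    -- the exponent `d` of the different and the discriminant exponent `δ`: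
    (d δ : ℤ)
    (hd : ∀ x : E, x ≠ 0 →
      ((∀ y : E, (y = 0 ∨ 0 ≤ vE y) →
          (Algebra.trace F E (x * y) = 0 ∨ 0 ≤ vF (Algebra.trace F E (x * y)))) ↔ -d ≤ vE x))
    (hδ : ∀ x : E, x ≠ 0 → vE x = d → δ = vF (Algebra.norm F x))
    -- the conductor-exponent invariant `c`:
    (c : E → ℤ)
    (hcond : ∀ x : E, x ≠ 0 → 0 ≤ vE x → Algebra.adjoin F ({x} : Set E) = ⊤ →
      ∀ t : E, t ≠ 0 →
        ((0 ≤ vE t ∧ ∀ y : E, (y = 0 ∨ 0 ≤ vE y) →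
            t * y ∈ Subring.closure
              ({w : E | ∃ a : F, (a = 0 ∨ 0 ≤ vF a) ∧ algebraMap F E a = w} ∪ {x}))
          ↔ c x ≤ vE t))
    (hscale : ∀ z : F, z ≠ 0 → ∀ x : E, x ≠ 0 →
      c (algebraMap F E z * x) = e * ((Module.finrank F E : ℤ) - 1) * vF z + c x)
    (γ : E) (hγ0 : γ ≠ 0) (hγgen : Algebra.adjoin F ({γ} : Set E) = ⊤)
    (hstab : lmulRange F E ≤ (lmulRange F E).comap
      ((LinearMap.id : Module.End F E →ₗ[F] Module.End F E) - adConj F E γ)) :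
    f * (c γ + ((Module.finrank F E : ℤ) - 1) * (-(vE γ)))
      = vF (LinearMap.det (Submodule.mapQ (lmulRange F E) (lmulRange F E)
            ((LinearMap.id : Module.End F E →ₗ[F] Module.End F E) - adConj F E γ) hstab))
          - δ := by
  have hF : IsNormalizedVal vF := ⟨hvFmul, hvFadd, hvFsurj⟩
  have hE : IsNormalizedVal vE := ⟨hvEmul, hvEadd, hvEsurj⟩
  have : Infinite E := Infinite.of_surjective vE fun m => (hvEsurj m).imp fun _ h => h.2
  have hδ' : δ = f * d := by
    obtain ⟨x, hx0, hx⟩ := hvEsurj d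
    rw [hδ x hx0 hx, hnorm x hx0, hx]
  obtain ⟨z, hz0, hz⟩ := exists_le_val_algebraMap_mul hF hE he1 hcompat 0 hγ0
  have hz0' : algebraMap F E z ≠ 0 := by simpa using hz0
  set x := algebraMap F E z * γ with hx
  have hx0 : x ≠ 0 := mul_ne_zero hz0' hγ0
  have hxgen : Algebra.adjoin F {x} = ⊤ := by
    rw [eq_top_iff, ← hγgen, Algebra.adjoin_le_iff, Set.singleton_subset_iff]
    have : γ = z⁻¹ • x := by
      rw [hx, ← Algebra.smul_def, inv_smul_smul₀ hz0]
    rw [this]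
    exact Subalgebra.smul_mem _ (Algebra.self_mem_adjoin_singleton F x) _
  have hc := conductorExponent_eq hF hE he1 hcompat hd hz hxgen (hcond x hx0 hz hxgen)
  have hstab' : lmulRange F E ≤ (lmulRange F E).comap
      ((LinearMap.id : Module.End F E →ₗ[F] Module.End F E) - adConj F E x) := by
    rwa [hx, adConj_algebraMap_mul hz0]
  obtain ⟨D, k, hdet, hD⟩ := exists_det_mapQ_id_sub_adConj_eq_norm hx0 hxgen hstab'
  simp only [hx, adConj_algebraMap_mul hz0] at hdet
  have hder0 : Polynomial.aeval x (Polynomial.derivative (minpoly F x)) ≠ 0 :=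
    (Algebra.IsSeparable.isSeparable F x).aeval_derivative_ne_zero (minpoly.aeval F x)
  have hN0 : Algebra.norm F x ≠ 0 := Algebra.norm_ne_zero_iff.2 hx0
  have hN0' : algebraMap F E (Algebra.norm F x) ≠ 0 := by simpa using hN0
  have hD0 : D ≠ 0 := by
    rintro rfl
    rw [mul_zero] at hD
    exact mul_ne_zero (pow_ne_zero _ (neg_ne_zero.2 one_ne_zero)) (mul_ne_zero hx0 hder0) hD.symm
  have hval := congr_arg vE hD
  rw [hE.map_neg_one_pow_mul k (mul_ne_zero hx0 hder0), hvEmul _ _ hN0' hD0,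
    hvEmul _ _ hx0 hder0, hcompat _ hN0, hnorm x hx0] at hval
  have hvx : vE x = e * vF z + vE γ := by rw [hx, hvEmul _ _ hz0' hγ0, hcompat z hz0]
  have hcx := hscale z hz0 γ hγ0
  rw [← hx] at hcx
  rw [hdet, hnorm D hD0, hδ', ← hef]
  rw [← hef] at hcx
  linear_combination f * (hc - hcx - hval) + f * (e * f - 1) * hvx
end

section
/- Let E = F[γ] be a separable extension of the local field F of degree n, with γ ∈ E^×, and let φ_γ ∈ F[t] be the minimal polynomial of γ with derivative φ'_γ. Then det_F(1 − Ad_γ ; End_F(E)/E) = N_{E/F}(γ^{1−n}·φ'_γ(γ)). -/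
open Module.Basis in
/-- The characteristic polynomial is multiplicative along an invariant submodule. -/
theorem LinearMap.charpoly_eq_charpoly_restrict_mul_charpoly_mapQ
    {R V : Type*} [CommRing R] [AddCommGroup V] [Module R V] [Module.Finite R V] [Module.Free R V]
    (W : Submodule R V) [Module.Free R W] [Module.Finite R W] [Module.Free R (V ⧸ W)]
    (e : V →ₗ[R] V) (he : W ≤ W.comap e) :
    e.charpoly = (e.restrict he).charpoly * (W.mapQ W e he).charpoly := by
  classical
  let bW := Module.Free.chooseBasis R W
  let bQ := Module.Free.chooseBasis R (V ⧸ W)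
  let b := sumQuot bW bQ
  let B : Matrix (Module.Free.ChooseBasisIndex R W) (Module.Free.ChooseBasisIndex R (V ⧸ W)) R :=
    Matrix.of fun i l ↦ (b.repr (e (b (Sum.inr l)))) (Sum.inl i)
  suffices LinearMap.toMatrix b b e = Matrix.fromBlocks
      (LinearMap.toMatrix bW bW (e.restrict he)) B 0
      (LinearMap.toMatrix bQ bQ (W.mapQ W e he)) by
    rw [← LinearMap.charpoly_toMatrix e b, this, Matrix.charpoly_fromBlocks_zero₂₁,
      LinearMap.charpoly_toMatrix, LinearMap.charpoly_toMatrix]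
  ext u v
  cases u with
  | inl i =>
    cases v with
    | inl k =>
      simp only [b, sumQuot_inl, Matrix.fromBlocks_apply₁₁, LinearMap.toMatrix_apply]
      apply sumQuot_repr_inl_of_mem
    | inr l => simp [LinearMap.toMatrix_apply, Matrix.fromBlocks_apply₁₂, B]
  | inr j =>
    cases v with
    | inl k =>
      suffices W.mkQ (e (bW k)) = 0 by simp [LinearMap.toMatrix_apply, b, this]
      rw [← LinearMap.mem_ker, Submodule.ker_mkQ]
      exact he (Submodule.coe_mem (bW k))
    | inr l =>
      simp only [LinearMap.toMatrix_apply, sumQuot_repr_inr, Matrix.fromBlocks_apply₂₂, b]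
      rw [← sumQuot_inr bW bQ l, W.mapQ_apply]
      simp

/-- The `A`-linear characteristic polynomial of precomposition by `f` on `M →ₗ[R] A`. -/
theorem LinearMap.charpoly_lcomp {R A M : Type*} [CommRing R] [CommRing A] [Algebra R A]
    [AddCommGroup M] [Module R M] [Module.Finite R M] [Module.Free R M]
    [Module.Finite A (M →ₗ[R] A)] [Module.Free A (M →ₗ[R] A)] (f : M →ₗ[R] M) :
    (LinearMap.lcomp A A f).charpoly = f.charpoly.map (algebraMap R A) := by
  classical
  let b := Module.Free.chooseBasis R M
  let B : Module.Basis _ A (M →ₗ[R] A) := (Pi.basisFun A _).map (b.constr A)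
  have hB : LinearMap.toMatrix B B (LinearMap.lcomp A A f) =
      ((LinearMap.toMatrix b b f).map (algebraMap R A)).transpose := by
    ext i j
    simp [B, LinearMap.toMatrix_apply, Module.Basis.constr_apply_fintype, Pi.single_apply,
      Algebra.algebraMap_eq_smul_one]
  rw [← LinearMap.charpoly_toMatrix _ B, hB, Matrix.charpoly_transpose, Matrix.charpoly_map,
    LinearMap.charpoly_toMatrix]

/-- If `f` acts as the scalar `μ` on an invariant line `W`, then `μ - f` has determinant
`f.charpoly'(μ)` on the quotient by `W`. -/
theorem LinearMap.det_smul_one_sub_mapQ_eq_eval_derivative_charpoly {K V : Type*} [Field K]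
    [AddCommGroup V] [Module K V] [FiniteDimensional K V] (W : Submodule K V)
    (hW : Module.finrank K W = 1) (f : V →ₗ[K] V) (hf : W ≤ W.comap f) (μ : K)
    (hμ : ∀ u ∈ W, f u = μ • u) :
    (μ • LinearMap.id - W.mapQ W f hf).det = f.charpoly.derivative.eval μ := by
  have hres : f.restrict hf = μ • LinearMap.id := LinearMap.ext fun u => Subtype.ext (hμ u u.2)
  have hline : (f.restrict hf).charpoly = Polynomial.X - Polynomial.C μ := by
    have h : μ • LinearMap.id = (0 : Module.End K W) - (-μ) • 1 := by
      ext
      simp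
    rw [hres, h, LinearMap.charpoly_sub_smul, LinearMap.charpoly_zero, hW]
    simp [sub_eq_add_neg]
  rw [f.charpoly_eq_charpoly_restrict_mul_charpoly_mapQ W hf, hline]
  simp [LinearMap.eval_charpoly, Algebra.algebraMap_eq_smul_one, Module.End.one_eq_id]

theorem LinearMap.det_eq_mul_det_mapQ_of_restrict_eq_smul {K V : Type*} [Field K]
    [AddCommGroup V] [Module K V] [FiniteDimensional K V] (W : Submodule K V)
    (hW : Module.finrank K W = 1) (f : V →ₗ[K] V) (hf : W ≤ W.comap f) (μ : K)
    (hμ : ∀ u ∈ W, f u = μ • u) :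
    f.det = μ * (W.mapQ W f hf).det := by
  have hres : f.restrict hf = μ • LinearMap.id := LinearMap.ext fun u => Subtype.ext (hμ u u.2)
  rw [LinearMap.det_eq_det_mul_det W f hf, hres, LinearMap.det_smul, hW, pow_one, LinearMap.det_id,
    mul_one]

theorem Algebra.charpoly_lmul_eq_minpoly {F E : Type*} [Field F] [Field E] [Algebra F E]
    [FiniteDimensional F E] {γ : E} (hγ : Algebra.adjoin F ({γ} : Set E) = ⊤) :
    LinearMap.charpoly (Algebra.lmul F E γ) = minpoly F γ := by
  let pb := PowerBasis.ofAdjoinEqTop (Algebra.IsIntegral.isIntegral γ) hγ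
  have h := charpoly_leftMulMatrix pb
  rw [PowerBasis.ofAdjoinEqTop_gen] at h
  rw [← LinearMap.charpoly_toMatrix _ pb.basis, ← h]
  rfl

section AdConj

variable {F E : Type*} [Field F] [Field E] [Algebra F E]

/-- `1 - Ad_γ` as an `E`-linear endomorphism of `End_F(E)`. -/
noncomputable def oneSubAdConj (F : Type*) {E : Type*} [Field F] [Field E] [Algebra F E] (γ : E) :
    (E →ₗ[F] E) →ₗ[E] (E →ₗ[F] E) :=
  LinearMap.id - γ • LinearMap.lcomp E E (Algebra.lmul F E γ⁻¹)

theorem restrictScalars_oneSubAdConj (γ : E) :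
    (oneSubAdConj F γ).restrictScalars F = LinearMap.id - adConj F E γ := by
  ext u x
  simp [oneSubAdConj, adConj]

theorem restrictScalars_span_id :
    (Submodule.span E {(LinearMap.id : E →ₗ[F] E)}).restrictScalars F = lmulRange F E := by
  ext u
  simp only [Submodule.restrictScalars_mem, Submodule.mem_span_singleton, lmulRange,
    LinearMap.mem_range]
  rfl

theorem lcomp_lmul_apply_of_mem_span_id (a : E) {u : E →ₗ[F] E}
    (hu : u ∈ Submodule.span E {(LinearMap.id : E →ₗ[F] E)}) :
    LinearMap.lcomp E E (Algebra.lmul F E a) u = a • u := by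
  obtain ⟨c, rfl⟩ := Submodule.mem_span_singleton.mp hu
  ext x
  simp [mul_left_comm]

theorem oneSubAdConj_comp_lcomp {γ : E} (hγ : γ ≠ 0) :
    oneSubAdConj F γ ∘ₗ LinearMap.lcomp E E (Algebra.lmul F E γ) =
      LinearMap.lcomp E E (Algebra.lmul F E γ) - γ • LinearMap.id := by
  ext u x
  simp [oneSubAdConj, hγ]

variable [FiniteDimensional F E]

theorem det_mapQ_oneSubAdConj_mul {γ : E} (hγ0 : γ ≠ 0)
    (hγ : Algebra.adjoin F ({γ} : Set E) = ⊤)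
    (hT : Submodule.span E {(LinearMap.id : E →ₗ[F] E)} ≤
      (Submodule.span E {(LinearMap.id : E →ₗ[F] E)}).comap (oneSubAdConj F γ)) :
    (Submodule.mapQ _ _ (oneSubAdConj F γ) hT).det * algebraMap F E (Algebra.norm F γ) =
      (-1) ^ (Module.finrank F E - 1) * γ *
        Polynomial.aeval γ (Polynomial.derivative (minpoly F γ)) := by
  set W := Submodule.span E {(LinearMap.id : E →ₗ[F] E)}
  set f := LinearMap.lcomp E E (Algebra.lmul F E γ) with hfdef
  have : Module.Finite E (E →ₗ[F] E) := Module.Finite.of_restrictScalars_finite F _ _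
  have hid : (LinearMap.id : E →ₗ[F] E) ≠ 0 := fun h => one_ne_zero (LinearMap.congr_fun h (1 : E))
  have hW : Module.finrank E W = 1 := finrank_span_singleton hid
  have hE : Module.finrank E (E →ₗ[F] E) = Module.finrank F E := by
    have h := Module.finrank_mul_finrank F E (E →ₗ[F] E)
    rw [Module.finrank_linearMap F F E E] at h
    exact Nat.eq_of_mul_eq_mul_left Module.finrank_pos h
  have hQ : Module.finrank E ((E →ₗ[F] E) ⧸ W) = Module.finrank F E - 1 := by
    rw [Submodule.finrank_quotient, hE, hW]
  have hf : W ≤ W.comap f := fun u hu => by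
    rw [Submodule.mem_comap, lcomp_lmul_apply_of_mem_span_id γ hu]
    exact W.smul_mem γ hu
  have hμ : ∀ u ∈ W, f u = γ • u := fun u => lcomp_lmul_apply_of_mem_span_id γ
  have hcharpoly : f.charpoly = (minpoly F γ).map (algebraMap F E) := by
    rw [hfdef, LinearMap.charpoly_lcomp, Algebra.charpoly_lmul_eq_minpoly hγ]
  have hdet : f.det = algebraMap F E (Algebra.norm F γ) := by
    rw [LinearMap.det_eq_sign_charpoly_coeff, hE, hfdef, LinearMap.charpoly_lcomp,
      Polynomial.coeff_map, Algebra.norm_apply, LinearMap.det_eq_sign_charpoly_coeff]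
    simp
  have hdetQ := LinearMap.det_eq_mul_det_mapQ_of_restrict_eq_smul W hW f hf γ hμ
  have hcomp : W.mapQ W (oneSubAdConj F γ) hT ∘ₗ W.mapQ W f hf =
      (-1 : E) • (γ • LinearMap.id - W.mapQ W f hf) := by
    refine Submodule.linearMap_qext _ (LinearMap.ext fun u => ?_)
    have h := congrArg W.mkQ (LinearMap.congr_fun (oneSubAdConj_comp_lcomp (F := F) hγ0) u)
    simpa [f] using h
  have hderiv := LinearMap.det_smul_one_sub_mapQ_eq_eval_derivative_charpoly W hW f hf γ hμ
  rw [hcharpoly, Polynomial.derivative_map, Polynomial.eval_map_algebraMap] at hderiv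
  have h := congrArg LinearMap.det hcomp
  rw [LinearMap.det_comp, LinearMap.det_smul, hQ, hderiv] at h
  rw [← hdet, hdetQ]
  linear_combination γ * h

end AdConj

/-- Let `E = F[γ]` be a finite separable extension of the local field `F` of
degree `n`, with `γ ∈ E^×`, and let `φ_γ ∈ F[t]` be the minimal polynomial of `γ` with
derivative `φ'_γ`.  Then `det_F(1 - Ad_γ ; End_F(E)/E) = N_{E/F}(γ^{1-n} · φ'_γ(γ))`. -/
theorem statement8
    (F E : Type*) [Field F] [Field E] [Algebra F E] [FiniteDimensional F E]
    [Algebra.IsSeparable F E]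
    (γ : E) (hγ0 : γ ≠ 0) (hγgen : Algebra.adjoin F ({γ} : Set E) = ⊤)
    (h₁ : lmulRange F E ≤ (lmulRange F E).comap
      ((LinearMap.id : Module.End F E →ₗ[F] Module.End F E) - adConj F E γ)) :
    LinearMap.det (Submodule.mapQ (lmulRange F E) (lmulRange F E)
        ((LinearMap.id : Module.End F E →ₗ[F] Module.End F E) - adConj F E γ) h₁)
      = Algebra.norm F
          (γ ^ (1 - (Module.finrank F E : ℤ))
            * Polynomial.aeval γ (Polynomial.derivative (minpoly F γ))) := by
  let W := Submodule.span E {(LinearMap.id : E →ₗ[F] E)}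
  have hW : W.restrictScalars F = lmulRange F E := restrictScalars_span_id
  have hT : W ≤ W.comap (oneSubAdConj F γ) := fun u hu => by
    have hu' : u ∈ lmulRange F E := hW ▸ hu
    have h := h₁ hu'
    rwa [Submodule.mem_comap, ← restrictScalars_oneSubAdConj, ← hW] at h
  let e : ((E →ₗ[F] E) ⧸ W) ≃ₗ[F] (Module.End F E ⧸ lmulRange F E) :=
    (Submodule.Quotient.restrictScalarsEquiv F W).symm ≪≫ₗ Submodule.quotEquivOfEq _ _ hW
  have hconj : Submodule.mapQ (lmulRange F E) (lmulRange F E)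
      ((LinearMap.id : Module.End F E →ₗ[F] Module.End F E) - adConj F E γ) h₁ =
      (e : _ →ₗ[F] _) ∘ₗ (W.mapQ W (oneSubAdConj F γ) hT).restrictScalars F ∘ₗ
        (e.symm : _ →ₗ[F] _) := by
    refine Submodule.linearMap_qext _ (LinearMap.ext fun u => ?_)
    exact congrArg (lmulRange F E).mkQ
      (LinearMap.congr_fun (restrictScalars_oneSubAdConj γ) u).symm
  rw [hconj, LinearMap.det_conj, LinearMap.det_restrictScalars]
  have hN : Algebra.norm F γ ≠ 0 := Algebra.norm_ne_zero_iff.mpr hγ0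
  have h := congrArg (Algebra.norm F) (det_mapQ_oneSubAdConj_mul hγ0 hγgen hT)
  have hsign : Algebra.norm F ((-1 : E) ^ (Module.finrank F E - 1)) = 1 := by
    rw [← map_one (algebraMap F E), ← map_neg, ← map_pow, Algebra.norm_algebraMap, ← pow_mul]
    exact Even.neg_one_pow (mul_comm _ (Module.finrank F E) ▸ Nat.even_mul_pred_self _)
  rw [map_mul, map_mul, map_mul, hsign, one_mul, Algebra.norm_algebraMap] at h
  have hpow : γ ^ (1 - (Module.finrank F E : ℤ)) * γ ^ Module.finrank F E = γ := by
    rw [← zpow_natCast, ← zpow_add₀ hγ0, sub_add_cancel, zpow_one]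
  refine mul_right_cancel₀ (pow_ne_zero (Module.finrank F E) hN) (h.trans ?_)
  rw [← map_pow, ← map_mul, ← map_mul, mul_right_comm, hpow]
end

section
/- Let F be a nonarchimedean local field with residue cardinality q, V an F-vector space of dimension N, and γ ∈ Aut_F(V) a quasi-regular elliptic element such that E = F[γ] is a separable field extension of F of degree N, with ramification index e, residue degree f, and discriminant exponent δ = δ(E/F). Then η_G(γ) := q^{−f(c̃_F(γ)+e−1)} satisfies η_G(γ) = |D_F(γ)| · q^{δ − f(e−1)}, where D_F(γ) = det_F(1 − Ad_γ ; 𝔤/E) with 𝔤 = End_F(V) and |·| the normalized absolute value. -/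
section

open Polynomial Module Pointwise

/-- Precomposition with multiplication by `a`, as an `E`-linear endomorphism of `End_F(E)`. -/
noncomputable def rightMulEnd (F : Type*) {E : Type*} [Field F] [Field E] [Algebra F E] (a : E) :
    Module.End F E →ₗ[E] Module.End F E where
  toFun u := u ∘ₗ Algebra.lmul F E a
  map_add' _ _ := rfl
  map_smul' _ _ := rfl

theorem rightMulEnd_eq_conj (F : Type*) {E ι : Type*} [Field F] [Field E] [Algebra F E]
    [Fintype ι] [DecidableEq ι] (b : Basis ι F E) (a : E) :
    rightMulEnd F a = (b.constr E (M' := E)).conj (Matrix.toLin'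
      ((Algebra.leftMulMatrix b a).transpose.map (algebraMap F E))) := by
  ext1 u
  refine b.ext fun i => ?_
  have h : a * b i = ∑ j, Algebra.leftMulMatrix b a j i • b j := by
    conv_lhs => rw [← b.sum_repr (a * b i)]
    simp [Algebra.leftMulMatrix_eq_repr_mul]
  simp [rightMulEnd, h, LinearEquiv.conj_apply, Matrix.mulVec, dotProduct]
  simp [Algebra.smul_def]

instance finite_end (F E : Type*) [Field F] [Field E] [Algebra F E] [FiniteDimensional F E] :
    Module.Finite E (Module.End F E) :=
  Module.Finite.equiv ((finBasis F E).constr E (M' := E))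

theorem charpoly_rightMulEnd (F : Type*) {E : Type*} [Field F] [Field E] [Algebra F E]
    [FiniteDimensional F E] {a : E} (ha : Algebra.adjoin F ({a} : Set E) = ⊤) :
    (rightMulEnd F a).charpoly = (minpoly F a).map (algebraMap F E) := by
  let pb := PowerBasis.ofAdjoinEqTop (Algebra.IsIntegral.isIntegral (R := F) a) ha
  have hpb : pb.gen = a := PowerBasis.ofAdjoinEqTop_gen _ ha
  have := charpoly_leftMulMatrix pb
  rw [hpb] at this
  rw [rightMulEnd_eq_conj F pb.basis a, LinearEquiv.charpoly_conj, Matrix.charpoly_toLin',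
    Matrix.charpoly_map, Matrix.charpoly_transpose, this]

theorem det_rightMulEnd (F : Type*) {E : Type*} [Field F] [Field E] [Algebra F E]
    [FiniteDimensional F E] (a : E) :
    LinearMap.det (rightMulEnd F a) = algebraMap F E (Algebra.norm F a) := by
  classical
  let b := finBasis F E
  rw [rightMulEnd_eq_conj F b a, LinearEquiv.conj_apply, LinearMap.comp_assoc,
    LinearMap.det_conj, LinearMap.det_toLin', Algebra.norm_eq_matrix_det b,
    RingHom.map_det, ← Matrix.det_transpose]
  rfl

theorem det_eq_mul_det_mapQ_span_singleton {K V : Type*} [Field K] [AddCommGroup V] [Module K V]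
    [FiniteDimensional K V] {g : V →ₗ[K] V} {w : V} (hw : w ≠ 0) {a : K} (hg : g w = a • w)
    (h : K ∙ w ≤ (K ∙ w).comap g) :
    LinearMap.det g = a * LinearMap.det ((K ∙ w).mapQ (K ∙ w) g h) := by
  rw [LinearMap.det_eq_det_mul_det (K ∙ w) g h]
  have : LinearMap.restrict g (p := K ∙ w) (q := K ∙ w) h = a • LinearMap.id := by
    ext ⟨v, hv⟩
    obtain ⟨s, rfl⟩ := Submodule.mem_span_singleton.1 hv
    simp [hg, smul_comm s a]
  rw [this, LinearMap.det_smul, finrank_span_singleton hw]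
  simp

theorem charpoly_eq_mul_charpoly_mapQ_span_singleton {K V : Type*} [Field K] [Infinite K]
    [AddCommGroup V] [Module K V] [FiniteDimensional K V] {g : V →ₗ[K] V} {w : V} (hw : w ≠ 0)
    {a : K} (hg : g w = a • w) (h : K ∙ w ≤ (K ∙ w).comap g) :
    g.charpoly = (X - C a) * ((K ∙ w).mapQ (K ∙ w) g h).charpoly := by
  refine Polynomial.funext fun s => ?_
  have h' : K ∙ w ≤ (K ∙ w).comap (algebraMap K (Module.End K V) s - g) := fun v hv =>
    Submodule.sub_mem _ (Submodule.smul_mem _ s hv) (h hv)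
  rw [eval_mul, LinearMap.eval_charpoly, LinearMap.eval_charpoly,
    det_eq_mul_det_mapQ_span_singleton hw (a := s - a) (by simp [hg, sub_smul]) h']
  congr 1
  · simp
  · congr 1
    ext v
    simp

theorem lmulRange_eq (F E : Type*) [Field F] [Field E] [Algebra F E] :
    lmulRange F E = (E ∙ (1 : Module.End F E)).restrictScalars F := by
  ext u
  simp only [lmulRange, LinearMap.mem_range, Submodule.restrictScalars_mem,
    Submodule.mem_span_singleton]
  refine exists_congr fun a => Eq.congr_left ?_
  ext
  simp

theorem adConj_smul {F E : Type*} [Field F] [Field E] [Algebra F E] {z : F} (hz : z ≠ 0) (γ : E) :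
    adConj F E (z • γ) = adConj F E γ := by
  have h : (z • γ)⁻¹ = z⁻¹ • γ⁻¹ := by
    rw [Algebra.smul_def, Algebra.smul_def, mul_inv, map_inv₀]
  ext u y
  simp [adConj, h, smul_smul, hz]

theorem det_mapQ_restrictScalars {F E V : Type*} [Field F] [Field E] [Algebra F E]
    [AddCommGroup V] [Module F V] [Module E V] [IsScalarTower F E V]
    {W' : Submodule F V} {W : Submodule E V} (hW : W' = W.restrictScalars F)
    {g' : V →ₗ[F] V} {g : V →ₗ[E] V} (hg : g' = g.restrictScalars F)
    (h' : W' ≤ W'.comap g') (h : W ≤ W.comap g) :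
    LinearMap.det (W'.mapQ W' g' h') = Algebra.norm F (LinearMap.det (W.mapQ W g h)) := by
  subst hW hg
  rw [← LinearMap.det_restrictScalars,
    ← LinearMap.det_conj _ (Submodule.Quotient.restrictScalarsEquiv F W)]
  congr 1
  ext v
  obtain ⟨v, rfl⟩ := Submodule.Quotient.mk_surjective _ v
  rfl

theorem det_mapQ_sub_span_singleton {K V : Type*} [Field K] [Infinite K]
    [AddCommGroup V] [Module K V] [FiniteDimensional K V] {g : V →ₗ[K] V} {w : V} (hw : w ≠ 0)
    {a : K} (hg : g w = a • w) (h : K ∙ w ≤ (K ∙ w).comap g)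
    (h' : K ∙ w ≤ (K ∙ w).comap (algebraMap K (Module.End K V) a - g)) :
    LinearMap.det ((K ∙ w).mapQ (K ∙ w) (algebraMap K (Module.End K V) a - g) h') =
      (derivative g.charpoly).eval a := by
  rw [charpoly_eq_mul_charpoly_mapQ_span_singleton hw hg h]
  simp only [derivative_mul, eval_add, eval_mul, eval_sub, eval_X, eval_C, sub_self, zero_mul,
    add_zero, derivative_sub, derivative_X, derivative_C, sub_zero, one_mul,
    LinearMap.eval_charpoly]
  congr 1
  ext v
  simp

theorem rightMulEnd_one (F : Type*) {E : Type*} [Field F] [Field E] [Algebra F E] (a : E) :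
    rightMulEnd F a 1 = a • (1 : Module.End F E) := by
  ext
  simp [rightMulEnd]

theorem span_singleton_le_comap {K V : Type*} [Field K] [AddCommGroup V] [Module K V]
    {g : V →ₗ[K] V} {w : V} {a : K} (hg : g w = a • w) : K ∙ w ≤ (K ∙ w).comap g := by
  rw [Submodule.span_singleton_le_iff_mem, Submodule.mem_comap, hg]
  exact Submodule.smul_mem _ a (Submodule.mem_span_singleton_self w)

theorem mapQ_smul {K V : Type*} [Field K] [AddCommGroup V] [Module K V] {W : Submodule K V}
    {g : V →ₗ[K] V} (h : W ≤ W.comap g) {a : K} (h' : W ≤ W.comap (a • g)) :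
    W.mapQ W (a • g) h' = a • W.mapQ W g h := by
  ext
  rfl

/-- The determinant of `1 - Ad_γ` on `End_F(E)/E` is, up to sign, the norm of
`h'(γ) γ / N(γ)`, where `h` is the minimal polynomial of `γ`. -/
theorem exists_det_one_sub_adConj {F E : Type*} [Field F] [Field E] [Algebra F E]
    [FiniteDimensional F E] [Infinite E] {γ : E} (hγ0 : γ ≠ 0)
    (hγ : Algebra.adjoin F ({γ} : Set E) = ⊤)
    (hstab : lmulRange F E ≤ (lmulRange F E).comap
      ((LinearMap.id : Module.End F E →ₗ[F] Module.End F E) - adConj F E γ)) :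
    ∃ n : ℕ, LinearMap.det (Submodule.mapQ (lmulRange F E) (lmulRange F E)
        ((LinearMap.id : Module.End F E →ₗ[F] Module.End F E) - adConj F E γ) hstab) =
      Algebra.norm F ((-1) ^ n * (γ * algebraMap F E (Algebra.norm F γ⁻¹)) *
        aeval γ (derivative (minpoly F γ))) := by
  have hone : (1 : Module.End F E) ≠ 0 := one_ne_zero
  have hR : ∀ a : E, _ := fun a => span_singleton_le_comap (rightMulEnd_one F a)
  have hT := span_singleton_le_comap (w := (1 : Module.End F E))
    (g := algebraMap E (Module.End E (Module.End F E)) γ - rightMulEnd F γ) (a := 0)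
    (by simp [rightMulEnd_one])
  have hg : (LinearMap.id : Module.End F E →ₗ[F] Module.End F E) - adConj F E γ =
      (((-1 : E) • rightMulEnd F γ⁻¹) ∘ₗ
        (algebraMap E (Module.End E (Module.End F E)) γ - rightMulEnd F γ)).restrictScalars F := by
    ext u y
    simp [adConj, rightMulEnd, hγ0]
  have hdetR := det_eq_mul_det_mapQ_span_singleton hone (rightMulEnd_one F γ⁻¹) (hR γ⁻¹)
  have hN : Submodule.span E {(1 : Module.End F E)} ≤
      (Submodule.span E {(1 : Module.End F E)}).comap ((-1 : E) • rightMulEnd F γ⁻¹) :=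
    fun v hv => Submodule.smul_mem _ _ (hR γ⁻¹ hv)
  rw [det_mapQ_restrictScalars (lmulRange_eq F E) hg hstab (fun v hv => hN (hT hv)),
    Submodule.mapQ_comp _ _ _ _ _ hT hN, LinearMap.det_comp,
    det_mapQ_sub_span_singleton hone (rightMulEnd_one F γ) (hR γ) hT,
    charpoly_rightMulEnd F hγ, mapQ_smul (hR γ⁻¹), LinearMap.det_smul,
    derivative_map, eval_map_algebraMap, ← det_rightMulEnd, hdetR, mul_inv_cancel_left₀ hγ0]
  exact ⟨_, rfl⟩

theorem forall_mul_mem_adjoin_iff_s19 (A : Type*) {F E : Type*} [CommRing A] [IsDomain A]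
    [IsIntegrallyClosed A] [Field F] [Field E] [Algebra A F] [IsFractionRing A F] [Algebra F E]
    [Algebra A E] [IsScalarTower A F E] [FiniteDimensional F E] [Algebra.IsSeparable F E]
    {x : E} (hgen : Algebra.adjoin F ({x} : Set E) = ⊤) (hint : IsIntegral A x)
    {B : Subring E} (hB : ∀ b ∈ Algebra.adjoin A ({x} : Set E), b ∈ B) (t : E) :
    (∀ y ∈ B, t * y ∈ Algebra.adjoin A ({x} : Set E)) ↔
      ∀ y ∈ B, Algebra.trace F E (t * (aeval x (derivative (minpoly F x)))⁻¹ * y) ∈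
        (1 : Submodule A F) := by
  have hdual := traceForm_dualSubmodule_adjoin A F hgen hint
  set D := aeval x (derivative (minpoly F x)) with hD
  have hD0 : D ≠ 0 :=
    (Algebra.IsSeparable.isSeparable F x).aeval_derivative_ne_zero (minpoly.aeval F x)
  have hmem (z : E) : z ∈ Algebra.adjoin A ({x} : Set E) ↔
      ∀ b ∈ Algebra.adjoin A ({x} : Set E), Algebra.trace F E (D⁻¹ * z * b) ∈
        (1 : Submodule A F) := by
    have h := SetLike.ext_iff.1 hdual (D⁻¹ * z)
    rw [Submodule.mem_smul_pointwise_iff_exists] at h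
    simp only [smul_eq_mul, mul_right_inj' (inv_ne_zero hD0), exists_eq_right] at h
    exact h.symm
  refine ⟨fun h y hy => ?_, fun h y hy => (hmem _).2 fun b hb => ?_⟩
  · convert (hmem _).1 (h y hy) 1 (one_mem _) using 2
    ring
  · convert h (y * b) (B.mul_mem hy (hB b hb)) using 2
    ring

/-- The valuation ring of an integer-valued valuation. -/
def intValuationSubring {K : Type*} [Field K] (v : K → ℤ)
    (hmul : ∀ x y : K, x ≠ 0 → y ≠ 0 → v (x * y) = v x + v y)
    (hadd : ∀ x y : K, x ≠ 0 → y ≠ 0 → x + y ≠ 0 → min (v x) (v y) ≤ v (x + y)) :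
    ValuationSubring K where
  carrier := {x | x = 0 ∨ 0 ≤ v x}
  zero_mem' := Or.inl rfl
  one_mem' := by
    have := hmul 1 1 one_ne_zero one_ne_zero
    rw [mul_one] at this
    exact Or.inr (by omega)
  mul_mem' {x y} hx hy := by
    by_cases hx0 : x = 0
    · simp [hx0]
    by_cases hy0 : y = 0
    · simp [hy0]
    have := hmul x y hx0 hy0
    simp only [Set.mem_ofPred_eq, hx0, hy0, false_or] at hx hy
    exact Or.inr (by omega)
  add_mem' {x y} hx hy := by
    by_cases hx0 : x = 0
    · simpa [hx0] using hy
    by_cases hy0 : y = 0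
    · simpa [hy0] using hx
    by_cases hxy : x + y = 0
    · exact Or.inl hxy
    have := hadd x y hx0 hy0 hxy
    simp only [Set.mem_ofPred_eq, hx0, hy0, false_or] at hx hy
    exact Or.inr (by omega)
  neg_mem' {x} hx := by
    by_cases hx0 : x = 0
    · simp [hx0]
    have h1 := hmul 1 1 one_ne_zero one_ne_zero
    have h2 := hmul (-1) (-1) (by simp) (by simp)
    have h3 := hmul (-1) x (by simp) hx0
    rw [mul_one] at h1
    rw [neg_one_mul, neg_neg] at h2
    rw [neg_one_mul] at h3
    simp only [Set.mem_ofPred_eq, hx0, false_or] at hx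
    exact Or.inr (by omega)
  mem_or_inv_mem' x := by
    by_cases hx0 : x = 0
    · exact Or.inl (Or.inl hx0)
    have h1 := hmul 1 1 one_ne_zero one_ne_zero
    have h2 := hmul x x⁻¹ hx0 (inv_ne_zero hx0)
    rw [mul_one] at h1
    rw [mul_inv_cancel₀ hx0] at h2
    rcases le_total 0 (v x) with h | h
    · exact Or.inl (Or.inr h)
    · exact Or.inr (Or.inr (by omega))

theorem exists_smul_isIntegral {F E : Type*} [Field F] [Field E] [Algebra F E]
    [FiniteDimensional F E] (A : ValuationSubring F) (x : E) :
    ∃ a : F, a ≠ 0 ∧ IsIntegral A (a • x) := by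
  have : Algebra.IsAlgebraic A F := IsLocalization.isAlgebraic F (nonZeroDivisors A)
  have := Algebra.IsAlgebraic.trans A F E
  obtain ⟨a, ha, h⟩ := (Algebra.IsAlgebraic.isAlgebraic (R := A) x).exists_integral_multiple
  exact ⟨a, by simpa using ha, h⟩

theorem intValuation_inv {K : Type*} [Field K] {v : K → ℤ}
    (hmul : ∀ x y : K, x ≠ 0 → y ≠ 0 → v (x * y) = v x + v y) {x : K} (hx : x ≠ 0) :
    v x⁻¹ = - v x := by
  have h1 := hmul 1 1 one_ne_zero one_ne_zero
  have h2 := hmul x x⁻¹ hx (inv_ne_zero hx)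
  rw [mul_one] at h1
  rw [mul_inv_cancel₀ hx] at h2
  omega

theorem intValuation_neg_one_pow {K : Type*} [Field K] {v : K → ℤ}
    (hmul : ∀ x y : K, x ≠ 0 → y ≠ 0 → v (x * y) = v x + v y) (n : ℕ) :
    v ((-1) ^ n) = 0 := by
  have h1 := hmul 1 1 one_ne_zero one_ne_zero
  have h2 := hmul ((-1) ^ n) ((-1) ^ n) (by simp) (by simp)
  rw [mul_one] at h1
  rw [← mul_pow, neg_one_mul, neg_neg, one_pow] at h2
  omega

/-- The conductor exponent of `x` plus the exponent of the different is the valuation of `h'(x)`,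
where `h` is the minimal polynomial of `x`. -/
theorem vE_aeval_derivative_minpoly
    {F E : Type*} [Field F] [Field E] [Algebra F E] [FiniteDimensional F E]
    [Algebra.IsSeparable F E] {vF : F → ℤ} {vE : E → ℤ}
    (hvFmul : ∀ x y : F, x ≠ 0 → y ≠ 0 → vF (x * y) = vF x + vF y)
    (hvFadd : ∀ x y : F, x ≠ 0 → y ≠ 0 → x + y ≠ 0 → min (vF x) (vF y) ≤ vF (x + y))
    (hvEmul : ∀ x y : E, x ≠ 0 → y ≠ 0 → vE (x * y) = vE x + vE y)
    (hvEadd : ∀ x y : E, x ≠ 0 → y ≠ 0 → x + y ≠ 0 → min (vE x) (vE y) ≤ vE (x + y))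
    (hvEsurj : ∀ m : ℤ, ∃ x : E, x ≠ 0 ∧ vE x = m)
    {e : ℤ} (he : 1 ≤ e) (hcompat : ∀ x : F, x ≠ 0 → vE (algebraMap F E x) = e * vF x)
    {d : ℤ}
    (hd : ∀ x : E, x ≠ 0 →
      ((∀ y : E, (y = 0 ∨ 0 ≤ vE y) →
          (Algebra.trace F E (x * y) = 0 ∨ 0 ≤ vF (Algebra.trace F E (x * y)))) ↔ -d ≤ vE x))
    {x : E} (hx : 0 ≤ vE x) (hgen : Algebra.adjoin F ({x} : Set E) = ⊤)
    (hint : IsIntegral (intValuationSubring vF hvFmul hvFadd) x) {c : ℤ}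
    (hc : ∀ t : E, t ≠ 0 →
        ((0 ≤ vE t ∧ ∀ y : E, (y = 0 ∨ 0 ≤ vE y) →
            t * y ∈ Subring.closure
              ({w : E | ∃ a : F, (a = 0 ∨ 0 ≤ vF a) ∧ algebraMap F E a = w} ∪ {x}))
          ↔ c ≤ vE t)) :
    vE (aeval x (derivative (minpoly F x))) = c + d := by
  set A := intValuationSubring vF hvFmul hvFadd
  let B := intValuationSubring vE hvEmul hvEadd
  set D := aeval x (derivative (minpoly F x)) with hD
  have hD0 : D ≠ 0 :=
    (Algebra.IsSeparable.isSeparable F x).aeval_derivative_ne_zero (minpoly.aeval F x)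
  have hset : {w : E | ∃ a : F, (a = 0 ∨ 0 ≤ vF a) ∧ algebraMap F E a = w} =
      Set.range (algebraMap A E) := by
    ext w
    exact ⟨fun ⟨a, ha, h⟩ => ⟨⟨a, ha⟩, h⟩, fun ⟨a, h⟩ => ⟨a, a.2, h⟩⟩
  have hadj : ∀ w, w ∈ Subring.closure
      ({w : E | ∃ a : F, (a = 0 ∨ 0 ≤ vF a) ∧ algebraMap F E a = w} ∪ {x}) ↔
        w ∈ Algebra.adjoin A ({x} : Set E) := fun w => by
    rw [hset, ← Algebra.adjoin_eq_ring_closure]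
    rfl
  have hB : ∀ b ∈ Algebra.adjoin A ({x} : Set E), b ∈ B.toSubring := by
    intro b hb
    rw [← hadj] at hb
    refine (Subring.closure_le (t := B.toSubring)).2 ?_ hb
    rintro w (⟨a, ha, rfl⟩ | rfl)
    · by_cases ha0 : a = 0
      · exact Or.inl (by simp [ha0])
      · refine Or.inr ?_
        rw [hcompat a ha0]
        exact mul_nonneg (by omega) (ha.resolve_left ha0)
    · exact Or.inr hx
  have hiff : ∀ t : E, t ≠ 0 → (c ≤ vE t ↔ vE D - d ≤ vE t) := fun t ht => by
    have h1 := forall_mul_mem_adjoin_iff_s19 A hgen hint hB t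
    have hone : ∀ a : F, a ∈ (1 : Submodule A F) ↔ a = 0 ∨ 0 ≤ vF a := fun a => by
      rw [Submodule.mem_one]
      exact ⟨fun ⟨b, h⟩ => h ▸ b.2, fun h => ⟨⟨a, h⟩, rfl⟩⟩
    have h2 := hd (t * D⁻¹) (mul_ne_zero ht (inv_ne_zero hD0))
    rw [hvEmul _ _ ht (inv_ne_zero hD0), intValuation_inv hvEmul hD0] at h2
    have h3 : (0 ≤ vE t ∧ ∀ y : E, (y = 0 ∨ 0 ≤ vE y) →
        t * y ∈ Algebra.adjoin A ({x} : Set E)) ↔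
        ∀ y ∈ B.toSubring, t * y ∈ Algebra.adjoin A ({x} : Set E) := by
      refine ⟨fun h => h.2, fun h => ⟨?_, h⟩⟩
      have := hB _ (h 1 (one_mem _))
      rw [mul_one] at this
      exact this.resolve_left ht
    rw [← hc t ht]
    simp only [hadj]
    rw [h3, h1]
    simp only [hone]
    refine Iff.trans h2 ?_
    omega
  obtain ⟨t, ht, htc⟩ := hvEsurj c
  obtain ⟨s, hs, hsc⟩ := hvEsurj (vE D - d)
  have h1 := hiff t ht
  have h2 := hiff s hs
  omega

end

/-- Let `F` be a nonarchimedean local field with residue cardinality `q`,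
and let `γ` be a quasi-regular elliptic element such that `E = F[γ]` is a *separable* field
extension of `F` of degree `N`, with ramification index `e`, residue degree `f`, and
discriminant exponent `δ = δ(E/F)`.  Then
`η_G(γ) := q^{-f(c̃_F(γ)+e-1)}` satisfies `η_G(γ) = |D_F(γ)| · q^{δ - f(e-1)}`, where
`D_F(γ) = det_F(1 - Ad_γ ; 𝔤/E)` with `𝔤 = End_F(E)`, `|x| = q^{-vF x}` is the normalized
absolute value, and `c̃_F(γ) = c_F(γ) + (N-1)·n_F(γ)` with `c` the conductor-exponent
invariant and `n_F(γ) = -vE γ`. -/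
theorem statement19
    (F E : Type*) [Field F] [Field E] [Algebra F E] [FiniteDimensional F E]
    [Algebra.IsSeparable F E]
    (vF : F → ℤ) (vE : E → ℤ)
    (hvFmul : ∀ x y : F, x ≠ 0 → y ≠ 0 → vF (x * y) = vF x + vF y)
    (hvFadd : ∀ x y : F, x ≠ 0 → y ≠ 0 → x + y ≠ 0 → min (vF x) (vF y) ≤ vF (x + y))
    (hvFsurj : ∀ m : ℤ, ∃ x : F, x ≠ 0 ∧ vF x = m)
    (hvEmul : ∀ x y : E, x ≠ 0 → y ≠ 0 → vE (x * y) = vE x + vE y)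
    (hvEadd : ∀ x y : E, x ≠ 0 → y ≠ 0 → x + y ≠ 0 → min (vE x) (vE y) ≤ vE (x + y))
    (hvEsurj : ∀ m : ℤ, ∃ x : E, x ≠ 0 ∧ vE x = m)
    -- `γ` is quasi-regular elliptic: `E = F[γ]` is a field of degree `N = [E:F]`:
    (γ : E) (hγ0 : γ ≠ 0) (hγgen : Algebra.adjoin F ({γ} : Set E) = ⊤)
    -- ramification index `e` and residue degree `f`:
    (e f : ℤ) (he1 : 1 ≤ e) (hf1 : 1 ≤ f)
    (hcompat : ∀ x : F, x ≠ 0 → vE (algebraMap F E x) = e * vF x)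
    (hef : e * f = (Module.finrank F E : ℤ))
    (hnorm : ∀ x : E, x ≠ 0 → vF (Algebra.norm F x) = f * vE x)
    -- the exponent `d` of the different and the discriminant exponent `δ`:
    (d δ : ℤ)
    (hd : ∀ x : E, x ≠ 0 →
      ((∀ y : E, (y = 0 ∨ 0 ≤ vE y) →
          (Algebra.trace F E (x * y) = 0 ∨ 0 ≤ vF (Algebra.trace F E (x * y)))) ↔ -d ≤ vE x))
    (hδ : ∀ x : E, x ≠ 0 → vE x = d → δ = vF (Algebra.norm F x))
    -- the conductor-exponent invariant `c`:
    (c : E → ℤ)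
    (hcond : ∀ x : E, x ≠ 0 → 0 ≤ vE x → Algebra.adjoin F ({x} : Set E) = ⊤ →
      ∀ t : E, t ≠ 0 →
        ((0 ≤ vE t ∧ ∀ y : E, (y = 0 ∨ 0 ≤ vE y) →
            t * y ∈ Subring.closure
              ({w : E | ∃ a : F, (a = 0 ∨ 0 ≤ vF a) ∧ algebraMap F E a = w} ∪ {x}))
          ↔ c x ≤ vE t))
    (hscale : ∀ z : F, z ≠ 0 → ∀ x : E, x ≠ 0 →
      c (algebraMap F E z * x) = e * ((Module.finrank F E : ℤ) - 1) * vF z + c x)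
    (hstab : lmulRange F E ≤ (lmulRange F E).comap
      ((LinearMap.id : Module.End F E →ₗ[F] Module.End F E) - adConj F E γ))
    -- `q` is the residue cardinality:
    (q : ℝ) (hq : 1 < q) :
    q ^ (-(f * ((c γ + ((Module.finrank F E : ℤ) - 1) * (-(vE γ))) + e - 1)))
      = q ^ (-(vF (LinearMap.det (Submodule.mapQ (lmulRange F E) (lmulRange F E)
            ((LinearMap.id : Module.End F E →ₗ[F] Module.End F E) - adConj F E γ) hstab))))
          * q ^ (δ - f * (e - 1)) := by
  have : Infinite E := Infinite.of_surjective vE fun m => (hvEsurj m).imp fun _ h => h.2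
  obtain ⟨a, ha0, ha⟩ := exists_smul_isIntegral (intValuationSubring vF hvFmul hvFadd) γ
  obtain ⟨b, hb0, hb⟩ := hvFsurj |vE (a • γ)|
  have hz0 : b * a ≠ 0 := mul_ne_zero hb0 ha0
  have hzE : algebraMap F E (b * a) ≠ 0 := by simpa using hz0
  set x := algebraMap F E (b * a) * γ with hxdef
  have hx0 : x ≠ 0 := mul_ne_zero hzE hγ0
  have hxab : x = algebraMap F E b * (a • γ) := by
    rw [hxdef, map_mul, Algebra.smul_def, mul_assoc]
  have hxpos : 0 ≤ vE x := by
    rw [hxab, hvEmul _ _ (by simpa using hb0) (smul_ne_zero ha0 hγ0), hcompat b hb0, hb]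
    nlinarith [neg_abs_le (vE (a • γ)), abs_nonneg (vE (a • γ))]
  have hbint : IsIntegral (intValuationSubring vF hvFmul hvFadd) (algebraMap F E b) :=
    isIntegral_algebraMap (x := (⟨b, Or.inr (hb ▸ abs_nonneg _)⟩ :
      intValuationSubring vF hvFmul hvFadd))
  have hxint : IsIntegral (intValuationSubring vF hvFmul hvFadd) x := hxab ▸ hbint.mul ha
  have hxgen : Algebra.adjoin F ({x} : Set E) = ⊤ := by
    rw [← top_le_iff, ← hγgen, Algebra.adjoin_le_iff, Set.singleton_subset_iff]
    have : γ = (b * a)⁻¹ • x := by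
      rw [hxdef, ← Algebra.smul_def, inv_smul_smul₀ hz0]
    rw [this]
    exact Subalgebra.smul_mem _ (Algebra.self_mem_adjoin_singleton F x) _
  have hAd : adConj F E γ = adConj F E x := by
    rw [hxdef, ← Algebra.smul_def, adConj_smul hz0]
  have hD0 : Polynomial.aeval x (Polynomial.derivative (minpoly F x)) ≠ 0 :=
    (Algebra.IsSeparable.isSeparable F x).aeval_derivative_ne_zero (minpoly.aeval F x)
  have hD := vE_aeval_derivative_minpoly hvFmul hvFadd hvEmul hvEadd hvEsurj he1 hcompat hd hxpos
    hxgen hxint (hcond x hx0 hxpos hxgen)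
  have hdet : vF (LinearMap.det (Submodule.mapQ (lmulRange F E) (lmulRange F E)
      ((LinearMap.id : Module.End F E →ₗ[F] Module.End F E) - adConj F E γ) hstab)) =
      f * (c x + d - (e * f - 1) * vE x) := by
    simp only [hAd] at hstab ⊢
    obtain ⟨n, hn⟩ := exists_det_one_sub_adConj hx0 hxgen hstab
    have hN0 : algebraMap F E (Algebra.norm F x⁻¹) ≠ 0 := by
      simpa [Algebra.norm_eq_zero_iff] using hx0
    have hs0 : ((-1) ^ n : E) ≠ 0 := by simp
    rw [hn, hnorm _ (mul_ne_zero (mul_ne_zero hs0 (mul_ne_zero hx0 hN0)) hD0),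
      hvEmul _ _ (mul_ne_zero hs0 (mul_ne_zero hx0 hN0)) hD0,
      hvEmul _ _ hs0 (mul_ne_zero hx0 hN0), hvEmul _ _ hx0 hN0, intValuation_neg_one_pow hvEmul,
      hcompat _ (by simpa using hN0), hnorm _ (inv_ne_zero hx0), intValuation_inv hvEmul hx0, hD]
    ring
  obtain ⟨t, ht0, ht⟩ := hvEsurj d
  have hδd := hδ t ht0 ht
  rw [hnorm t ht0, ht] at hδd
  have hvx : vE x = e * vF (b * a) + vE γ := by
    rw [hvEmul _ _ hzE hγ0, hcompat _ hz0]
  rw [← zpow_add₀ (by positivity), hdet, hδd, hvx, hscale _ hz0 γ hγ0, ← hef]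
  congr 1
  ring
end
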